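/- The algebra R(A,𝔫,L) is factorially K-graded: every homogeneous nonzero nonunit of R(A,𝔫,L) is a product of K-prime elements. Moreover the K-grading is effective (the degrees Q(e_{ij}) generate K). -/

import Mathlib

open MvPolynomial

section Setup

variable (𝕂 : Type) [Field 𝕂] [IsAlgClosed 𝕂] [CharZero 𝕂]
variable (r : ℕ) (a : Fin (r+1) → 𝕂 × 𝕂) (n : Fin (r+1) → ℕ)
variable (l : ∀ i : Fin (r+1), Fin (n i) → ℕ)

/-- The index set of the variables `T_{ij}`, `0 ≤ i ≤ r`, `1 ≤ j ≤ n_i`. -/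
abbrev Idx (r : ℕ) (n : Fin (r+1) → ℕ) := Σ i : Fin (r+1), Fin (n i)

/-- The monomial `T_i^{l_i} = T_{i1}^{l_{i1}} ⋯ T_{i n_i}^{l_{i n_i}}`. -/
noncomputable def mono (i : Fin (r+1)) : MvPolynomial (Idx r n) 𝕂 :=
  ∏ j : Fin (n i), (X ⟨i, j⟩ : MvPolynomial (Idx r n) 𝕂) ^ l i j

/-- `α_{ij} = det(a_i, a_j)`. -/
def alpha (i k : Fin (r+1)) : 𝕂 := (a i).1 * (a k).2 - (a k).1 * (a i).2

/-- The trinomial `g_{i,j,k} = α_{jk} T_i^{l_i} + α_{ki} T_j^{l_j} + α_{ij} T_k^{l_k}`. -/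
noncomputable def gPoly (i j k : Fin (r+1)) : MvPolynomial (Idx r n) 𝕂 :=
  C (alpha 𝕂 r a j k) * mono 𝕂 r n l i + C (alpha 𝕂 r a k i) * mono 𝕂 r n l j +
    C (alpha 𝕂 r a i j) * mono 𝕂 r n l k

/-- The ideal `⟨g_{i,i+1,i+2} ; 0 ≤ i ≤ r-2⟩`. -/
noncomputable def relIdeal : Ideal (MvPolynomial (Idx r n) 𝕂) :=
  Ideal.span { p | ∃ i j k : Fin (r+1), (j : ℕ) = (i : ℕ) + 1 ∧ (k : ℕ) = (i : ℕ) + 2 ∧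
    p = gPoly 𝕂 r a n l i j k }

/-- The ring `R(A, 𝔫, L)`. -/
abbrev RAnL := MvPolynomial (Idx r n) 𝕂 ⧸ relIdeal 𝕂 r a n l

/-- Row `i` (for `1 ≤ i ≤ r`) of the `r × n` matrix `P`. -/
def Prow (i : Fin r) : Idx r n → ℤ :=
  fun x => if x.1 = 0 then -(l x.1 x.2 : ℤ) else if x.1 = i.succ then (l x.1 x.2 : ℤ) else 0

/-- The subgroup of `ℤ^n` generated by the rows of `P`. -/
def rowSpan : AddSubgroup (Idx r n → ℤ) := AddSubgroup.closure (Set.range (Prow r n l))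

/-- The grading group `K = ℤ^n / P^*(M)`. -/
abbrev Kgrp := (Idx r n → ℤ) ⧸ rowSpan r n l

/-- The projection `Q : ℤ^n → K`. -/
noncomputable def Qmap : (Idx r n → ℤ) →+ Kgrp r n l := QuotientAddGroup.mk' (rowSpan r n l)

/-- The weight `deg T_{ij} := Q(e_{ij})` defining the `K`-grading of `S`. -/
noncomputable def wK : Idx r n → Kgrp r n l := fun x => Qmap r n l (Pi.single x (1 : ℤ))

/-- An element of `R(A,𝔫,L)` is homogeneous of degree `d` if it is the image of a
`K`-homogeneous polynomial of degree `d`. -/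
def IsHomog (d : Kgrp r n l) (y : RAnL 𝕂 r a n l) : Prop :=
  ∃ p : MvPolynomial (Idx r n) 𝕂, p.IsWeightedHomogeneous (wK r n l) d ∧
    Ideal.Quotient.mk (relIdeal 𝕂 r a n l) p = y

/-- `K`-prime elements of `R(A,𝔫,L)`. -/
def KPrime (f : RAnL 𝕂 r a n l) : Prop :=
  (∃ d, IsHomog 𝕂 r a n l d f) ∧ f ≠ 0 ∧ ¬ IsUnit f ∧
    ∀ x y : RAnL 𝕂 r a n l, (∃ d, IsHomog 𝕂 r a n l d x) → (∃ d, IsHomog 𝕂 r a n l d y) →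
      f ∣ x * y → f ∣ x ∨ f ∣ y

end Setup

section FactoriallyGraded

/-- The value at `(u, v)` of the homogenization of a nonzero univariate polynomial over an
algebraically closed field is a product of constants and linear forms in `u` and `v`. -/
theorem aeval_homogenize_mem_of_linear_mem {K R : Type*} [Field K] [IsAlgClosed K] [CommRing R]
    [Algebra K R] (u v : R) (N : Submonoid R) (hc : ∀ c : K, c ≠ 0 → algebraMap K R c ∈ N)
    (hN : ∀ q : K × K, q ≠ 0 → q.1 • u + q.2 • v ∈ N) (P : Polynomial K) (hP : P ≠ 0) (m : ℕ)
    (hm : P.natDegree ≤ m) : aeval ![u, v] (P.homogenize m) ∈ N := by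
  have hroots : ∀ s : Multiset K, aeval ![u, v]
      ((s.map fun t => Polynomial.X - Polynomial.C t).prod.homogenize s.card) ∈ N := by
    intro s
    induction s using Multiset.induction_on with
    | empty => simp
    | cons t s ih =>
      rw [Multiset.map_cons, Multiset.prod_cons, Multiset.card_cons, add_comm s.card 1,
        Polynomial.homogenize_mul _ _ (Polynomial.natDegree_X_sub_C_le t)
          (Polynomial.natDegree_multiset_prod_X_sub_C_eq_card s).le, map_mul]
      refine mul_mem ?_ ih
      have := hN (1, -t) (by simp)
      simpa [sub_eq_add_neg, Algebra.smul_def] using this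
  have hs : P.Splits := IsAlgClosed.splits P
  have hcard : P.natDegree = P.roots.card := hs.natDegree_eq_card_roots
  have hfac : P.homogenize m = C P.leadingCoeff *
      ((P.roots.map fun t => Polynomial.X - Polynomial.C t).prod.homogenize P.roots.card *
        X 1 ^ (m - P.roots.card)) := by
    conv_lhs => rw [hs.eq_prod_roots]
    rw [Polynomial.homogenize_C_mul, ← Polynomial.homogenize_one, ← Polynomial.homogenize_mul,
      mul_one]
    · congr 2
      omega
    · exact (Polynomial.natDegree_multiset_prod_X_sub_C_eq_card _).le
    · simp
  rw [hfac, map_mul, map_mul, map_pow, aeval_C]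
  refine mul_mem (hc _ (by simpa using hP)) (mul_mem (hroots _) (pow_mem ?_ _))
  simpa using hN (0, 1) (by simp)

/-- Over an algebraically closed field, `∏ t_j ^ e_j = w` has a solution with `t_j = 1` away from
a given index. -/
theorem exists_prod_pow_eq {K : Type*} [Field K] [IsAlgClosed K] {N : ℕ} (e : Fin N → ℕ)
    (j₀ : Fin N) (he : 0 < e j₀) (w : K) :
    ∃ t : Fin N → K, ∏ j, t j ^ e j = w ∧ ∀ j, t j = 0 ↔ j = j₀ ∧ w = 0 := by
  obtain ⟨z, hz⟩ := IsAlgClosed.exists_pow_nat_eq w he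
  refine ⟨Function.update 1 j₀ z, ?_, fun j => ?_⟩
  · rw [Finset.prod_eq_single j₀]
    · simpa using hz
    · intro j _ hj
      simp [Function.update_of_ne hj]
    · simp
  · rcases eq_or_ne j j₀ with rfl | hj
    · simp [← hz, he.ne']
    · simp [hj]

variable {𝕂 : Type} [Field 𝕂] {r : ℕ} {a : Fin (r+1) → 𝕂 × 𝕂} {n : Fin (r+1) → ℕ}
  {l : ∀ i : Fin (r+1), Fin (n i) → ℕ}

theorem smul_eq_algebraMap_mul (c : 𝕂) (x : RAnL 𝕂 r a n l) :
    c • x = algebraMap 𝕂 (RAnL 𝕂 r a n l) c * x :=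
  Algebra.smul_def c x

theorem alpha_ne_zero (ha : ∀ i k : Fin (r+1), i ≠ k → LinearIndependent 𝕂 ![a i, a k])
    {i k : Fin (r+1)} (hik : i ≠ k) : alpha 𝕂 r a i k ≠ 0 := by
  intro h
  have := LinearIndependent.pair_iff.1 (ha i k hik)
  have h1 := this (a k).2 (-(a i).2) (by
    ext
    · simp only [alpha] at h
      simp only [Prod.fst_add, Prod.smul_fst, smul_eq_mul, Prod.fst_zero]
      linear_combination h
    · simp only [Prod.snd_add, Prod.smul_snd, smul_eq_mul, Prod.snd_zero]
      ring)
  have h2 := this (a k).1 (-(a i).1) (by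
    ext
    · simp only [Prod.fst_add, Prod.smul_fst, smul_eq_mul, Prod.fst_zero]
      ring
    · simp only [alpha] at h
      simp only [Prod.snd_add, Prod.smul_snd, smul_eq_mul, Prod.snd_zero]
      linear_combination -h)
  have := this 1 0 (by
    ext
    · simpa using h2.2
    · simpa using h1.2)
  exact one_ne_zero this.1

/-- Elements of the row span of `P` are integral combinations `∑ k_i l_i` with `∑ k_i = 0`. -/
theorem exists_of_mem_rowSpan {v : Idx r n → ℤ} (hv : v ∈ rowSpan r n l) :
    ∃ k : Fin (r+1) → ℤ, ∑ i, k i = 0 ∧ ∀ x, v x = k x.1 * l x.1 x.2 := by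
  induction hv using AddSubgroup.closure_induction with
  | mem v hv =>
    obtain ⟨i, rfl⟩ := hv
    refine ⟨Pi.single i.succ 1 - Pi.single 0 1, by simp, fun x => ?_⟩
    simp only [Prow, Pi.sub_apply, Pi.single_apply]
    rcases eq_or_ne x.1 0 with h | h
    · simp [h, (Fin.succ_ne_zero i).symm]
    · simp [h]
  | zero => exact ⟨0, by simp, by simp⟩
  | add v w _ _ hv hw =>
    obtain ⟨k, hk, hkv⟩ := hv
    obtain ⟨k', hk', hkw⟩ := hw
    exact ⟨k + k', by simp [Finset.sum_add_distrib, hk, hk'], fun x => by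
      simp [hkv, hkw, add_mul]⟩
  | neg v _ hv =>
    obtain ⟨k, hk, hkv⟩ := hv
    exact ⟨-k, by simp [hk], fun x => by simp [hkv]⟩

theorem sum_smul_wK (v : Idx r n → ℤ) : ∑ x, v x • wK r n l x = Qmap r n l v := by
  simp only [wK, ← map_zsmul, ← map_sum]
  congr 1
  ext y
  simp [Finset.sum_apply, Pi.single_apply]

theorem weight_wK (v : Idx r n →₀ ℕ) :
    Finsupp.weight (wK r n l) v = Qmap r n l fun x => (v x : ℤ) := by
  rw [← sum_smul_wK, Finsupp.weight_apply, Finsupp.sum_fintype _ _ (by simp)]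
  simp

theorem closure_range_wK : AddSubgroup.closure (Set.range (wK r n l)) = ⊤ := by
  refine eq_top_iff.2 fun q _ => ?_
  obtain ⟨v, rfl⟩ := QuotientAddGroup.mk'_surjective _ q
  change Qmap r n l v ∈ _
  rw [← sum_smul_wK]
  exact sum_mem fun x _ => zsmul_mem (AddSubgroup.subset_closure (Set.mem_range_self x)) _

/-- The degree shared by all monomials `T_i^{l_i}`. -/
theorem isWeightedHomogeneous_mono (i : Fin (r+1)) :
    (mono 𝕂 r n l i).IsWeightedHomogeneous (wK r n l)
      (Qmap r n l fun x => if x.1 = 0 then (l x.1 x.2 : ℤ) else 0) := by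
  have h : (mono 𝕂 r n l i).IsWeightedHomogeneous (wK r n l)
      (Qmap r n l fun x => if x.1 = i then (l x.1 x.2 : ℤ) else 0) := by
    have := IsWeightedHomogeneous.prod (R := 𝕂) Finset.univ
      (fun j : Fin (n i) => (X ⟨i, j⟩ : MvPolynomial (Idx r n) 𝕂) ^ l i j)
      (fun j => l i j • wK r n l ⟨i, j⟩) (w := wK r n l)
      fun j _ => (isWeightedHomogeneous_X 𝕂 (wK r n l) _).pow _
    have hdeg : (Qmap r n l fun x => if x.1 = i then (l x.1 x.2 : ℤ) else 0) =
        ∑ j, l i j • wK r n l ⟨i, j⟩ := by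
      rw [← sum_smul_wK, Fintype.sum_sigma, Finset.sum_eq_single i]
      · simp
      · intro k _ hk
        simp [hk]
      · simp
    rw [hdeg]
    exact this
  convert h using 1
  rcases Fin.eq_zero_or_eq_succ i with rfl | ⟨k, rfl⟩
  · rfl
  · refine (QuotientAddGroup.eq (s := rowSpan r n l)).2 (AddSubgroup.subset_closure ⟨k, ?_⟩)
    ext x
    rcases eq_or_ne x.1 0 with h0 | h0
    · simp [Prow, h0, (Fin.succ_ne_zero k).symm]
    · simp [Prow, h0]

/-- `R(A, 𝔫, L)` contains homogeneous elements `u`, `v` of equal degree such that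
`T_i^{l_i} = b_i u + c_i v` for all `i`. -/
theorem exists_mono_eq_linear (hr : 1 ≤ r)
    (ha : ∀ i k : Fin (r+1), i ≠ k → LinearIndependent 𝕂 ![a i, a k]) :
    ∃ u v : RAnL 𝕂 r a n l,
      (∀ i, Ideal.Quotient.mk (relIdeal 𝕂 r a n l) (mono 𝕂 r n l i) =
        (a i).1 • u + (a i).2 • v) ∧
      ∀ q : 𝕂 × 𝕂, ∃ d, IsHomog 𝕂 r a n l d (q.1 • u + q.2 • v) := by
  set M : ℕ → RAnL 𝕂 r a n l := fun i =>
    if h : i < r + 1 then Ideal.Quotient.mk (relIdeal 𝕂 r a n l) (mono 𝕂 r n l ⟨i, h⟩) else 0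
    with hMdef
  have hM : ∀ i (h : i < r + 1),
      M i = Ideal.Quotient.mk (relIdeal 𝕂 r a n l) (mono 𝕂 r n l ⟨i, h⟩) := fun i h => by
    simp only [hMdef, dif_pos h]
  let i₀ : Fin (r+1) := ⟨0, by omega⟩
  let i₁ : Fin (r+1) := ⟨1, by omega⟩
  have hα : alpha 𝕂 r a i₀ i₁ ≠ 0 := alpha_ne_zero ha (by simp [i₀, i₁])
  set δ := (alpha 𝕂 r a i₀ i₁)⁻¹
  have hδ' : δ * ((a i₀).1 * (a i₁).2 - (a i₁).1 * (a i₀).2) = 1 := inv_mul_cancel₀ hα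
  let u : RAnL 𝕂 r a n l := (δ * (a i₁).2) • M 0 + (-δ * (a i₀).2) • M 1
  let v : RAnL 𝕂 r a n l := (-δ * (a i₁).1) • M 0 + (δ * (a i₀).1) • M 1
  have key : ∀ i (h : i < r + 1), M i = (a ⟨i, h⟩).1 • u + (a ⟨i, h⟩).2 • v := by
    intro i
    induction i using Nat.strong_induction_on with
    | _ i ih =>
    intro h
    match i, ih, h with
    | 0, _, h =>
      change M 0 = (a i₀).1 • u + (a i₀).2 • v
      simp only [u, v]
      match_scalars
      · linear_combination -hδ'
      · ring
    | 1, _, h =>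
      change M 1 = (a i₁).1 • u + (a i₁).2 • v
      simp only [u, v]
      match_scalars
      · linear_combination -hδ'
      · ring
    | i + 2, ih, h =>
      have e0 := ih i (by omega) (by omega)
      have e1 := ih (i + 1) (by omega) (by omega)
      have hg : Ideal.Quotient.mk (relIdeal 𝕂 r a n l)
          (gPoly 𝕂 r a n l ⟨i, by omega⟩ ⟨i + 1, by omega⟩ ⟨i + 2, h⟩) = 0 :=
        Ideal.Quotient.eq_zero_iff_mem.2 (Ideal.subset_span ⟨_, _, _, rfl, rfl, rfl⟩)
      have hC : ∀ c : 𝕂, ∀ p : MvPolynomial (Idx r n) 𝕂,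
          Ideal.Quotient.mk (relIdeal 𝕂 r a n l) (C c * p) =
            c • Ideal.Quotient.mk (relIdeal 𝕂 r a n l) p := fun c p => by
        rw [← smul_eq_C_mul]; rfl
      simp only [gPoly, map_add, hC] at hg
      rw [← hM, ← hM, ← hM, e0, e1] at hg
      have hne : alpha 𝕂 r a ⟨i, by omega⟩ ⟨i + 1, by omega⟩ ≠ 0 := alpha_ne_zero ha (by simp)
      refine smul_right_injective _ hne ?_
      simp only
      rw [← sub_eq_zero, ← hg, ← sub_eq_zero]
      simp only [alpha]
      match_scalars <;> ring
  refine ⟨u, v, fun i => by rw [← key i.1 i.2, hM], fun q => ?_⟩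
  have hu : ∃ s t : 𝕂, q.1 • u + q.2 • v = s • M 0 + t • M 1 :=
    ⟨q.1 * (δ * (a i₁).2) + q.2 * (-δ * (a i₁).1), q.1 * (-δ * (a i₀).2) + q.2 * (δ * (a i₀).1), by
      simp only [u, v]; module⟩
  obtain ⟨s, t, hst⟩ := hu
  refine ⟨_, C s * mono 𝕂 r n l i₀ + C t * mono 𝕂 r n l i₁,
    ((isWeightedHomogeneous_mono i₀).C_mul s).add ((isWeightedHomogeneous_mono i₁).C_mul t), ?_⟩
  rw [hst, hM 0 (by omega), hM 1 (by omega), map_add, ← smul_eq_C_mul, ← smul_eq_C_mul]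
  rfl

/-- Nonzero homogeneous elements of `R(A, 𝔫, L)` are products of nonzero constants, variables and
linear forms in `u`, `v`. -/
theorem mem_of_isHomog [IsAlgClosed 𝕂] (hn : ∀ i, 0 < n i) (hl : ∀ i j, 0 < l i j)
    {u v : RAnL 𝕂 r a n l}
    (hM : ∀ i, Ideal.Quotient.mk (relIdeal 𝕂 r a n l) (mono 𝕂 r n l i) =
      (a i).1 • u + (a i).2 • v)
    (N : Submonoid (RAnL 𝕂 r a n l)) (hc : ∀ c : 𝕂, c ≠ 0 → algebraMap 𝕂 _ c ∈ N)
    (hT : ∀ x, Ideal.Quotient.mk (relIdeal 𝕂 r a n l) (X x) ∈ N)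
    (hN : ∀ q : 𝕂 × 𝕂, q ≠ 0 → q.1 • u + q.2 • v ∈ N)
    {f : RAnL 𝕂 r a n l} {d : Kgrp r n l} (hf : IsHomog 𝕂 r a n l d f) (hf0 : f ≠ 0) : f ∈ N := by
  obtain ⟨p, hp, rfl⟩ := hf
  have hp0 : p ≠ 0 := by rintro rfl; simp at hf0
  obtain ⟨v₀, hv₀⟩ := ne_zero_iff.1 hp0
  have hred : ∀ i, ∃ m : ℕ, (∀ j, m * l i j ≤ v₀ ⟨i, j⟩) ∧ ∃ j, v₀ ⟨i, j⟩ < (m + 1) * l i j := by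
    intro i
    have : Nonempty (Fin (n i)) := ⟨⟨0, hn i⟩⟩
    obtain ⟨j, hj⟩ := Finite.exists_min fun j => v₀ ⟨i, j⟩ / l i j
    refine ⟨v₀ ⟨i, j⟩ / l i j, fun k => ?_, j, Nat.lt_mul_of_div_lt (Nat.lt_succ_self _) (hl i j)⟩
    exact (Nat.mul_le_mul_right _ (hj k)).trans (Nat.div_mul_le_self _ _)
  choose m hm hm' using hred
  have hexp : ∀ w ∈ p.support, ∃ e : Fin (r+1) → ℕ, ∑ i, e i = ∑ i, m i ∧
      ∀ x, w x = (v₀ x - m x.1 * l x.1 x.2) + e x.1 * l x.1 x.2 := by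
    intro w hw
    have hdeg := (hp hv₀).trans (hp (mem_support_iff.1 hw)).symm
    rw [weight_wK, weight_wK] at hdeg
    obtain ⟨k, hk, hkx⟩ := exists_of_mem_rowSpan
      ((QuotientAddGroup.eq (s := rowSpan r n l)).1 hdeg)
    simp only [Pi.add_apply, Pi.neg_apply] at hkx
    have hnn : ∀ i, 0 ≤ (m i : ℤ) + k i := by
      intro i
      obtain ⟨j, hj⟩ := hm' i
      have h1 := hkx ⟨i, j⟩
      have h2 : (v₀ ⟨i, j⟩ : ℤ) < (m i + 1) * l i j := by exact_mod_cast hj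
      have h3 : (0 : ℤ) < l i j := by exact_mod_cast hl i j
      by_contra! hneg
      simp only at h1
      nlinarith [(Nat.cast_nonneg (w ⟨i, j⟩) : (0 : ℤ) ≤ _)]
    refine ⟨fun i => ((m i : ℤ) + k i).toNat, ?_, fun x => ?_⟩
    · zify
      simp [hnn, Finset.sum_add_distrib, hk]
    · have h1 := hkx x
      zify [hm x.1 x.2]
      rw [Int.toNat_of_nonneg (hnn _)]
      linear_combination h1
  choose! e he hex using hexp
  set D := ∑ i, m i with hD
  set L : Fin (r+1) → Polynomial 𝕂 := fun i =>
    Polynomial.C (a i).1 * Polynomial.X + Polynomial.C (a i).2 with hL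
  have hLdeg : ∀ i, (L i).natDegree ≤ 1 := fun i => Polynomial.natDegree_linear_le
  set P : Polynomial 𝕂 := ∑ w ∈ p.support, Polynomial.C (coeff w p) * ∏ i, L i ^ e w i with hP
  have hLpow : ∀ i k, ((L i) ^ k).natDegree ≤ k := fun i k =>
    Polynomial.natDegree_pow_le.trans (by simpa using Nat.mul_le_mul_left k (hLdeg i))
  have hPdeg : P.natDegree ≤ D := by
    refine Polynomial.natDegree_sum_le_of_forall_le _ _ fun w hw => ?_
    refine (Polynomial.natDegree_C_mul_le _ _).trans ((Polynomial.natDegree_prod_le _ _).trans ?_)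
    rw [← he w hw]
    exact Finset.sum_le_sum fun i _ => hLpow i _
  have hLhom : ∀ i k, aeval ![u, v] ((L i ^ k).homogenize k) = ((a i).1 • u + (a i).2 • v) ^ k := by
    intro i k
    induction k with
    | zero => simp
    | succ k ih =>
      rw [pow_succ, Polynomial.homogenize_mul _ _ (hLpow i k) (hLdeg i), map_mul, ih, pow_succ]
      simp [hL, smul_eq_algebraMap_mul]
  have hval : Ideal.Quotient.mk (relIdeal 𝕂 r a n l) p =
      (∏ x : Idx r n, Ideal.Quotient.mk (relIdeal 𝕂 r a n l) (X x) ^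
        (v₀ x - m x.1 * l x.1 x.2)) * aeval ![u, v] (P.homogenize D) := by
    rw [hP, Polynomial.homogenize_finsetSum, map_sum, Finset.mul_sum]
    conv_lhs => rw [p.as_sum]
    rw [map_sum]
    refine Finset.sum_congr rfl fun w hw => ?_
    rw [Polynomial.homogenize_C_mul, ← he w hw,
      Polynomial.homogenize_finsetProd fun i _ => hLpow i _, map_mul, map_prod, aeval_C]
    simp only [hLhom, ← hM, mono]
    rw [monomial_eq, Finsupp.prod_fintype _ _ (by simp), map_mul, map_prod, mul_left_comm]
    congr 1
    simp only [map_pow, map_prod, ← Finset.prod_pow]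
    rw [Fintype.prod_sigma, Fintype.prod_sigma, ← Finset.prod_mul_distrib]
    refine Finset.prod_congr rfl fun i _ => ?_
    rw [← Finset.prod_mul_distrib]
    refine Finset.prod_congr rfl fun j _ => ?_
    rw [hex w hw ⟨i, j⟩, pow_add, ← pow_mul, mul_comm (e w i)]
  have hP0 : P ≠ 0 := by
    intro h
    rw [hval, h] at hf0
    simp at hf0
  rw [hval]
  exact mul_mem (prod_mem fun x _ => pow_mem (hT x) _)
    (aeval_homogenize_mem_of_linear_mem u v N hc hN P hP0 D hPdeg)

/-- For every `(s, t)` and every choice of an index in each block there is a point of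
`Spec R(A, 𝔫, L)` over `(s, t)` at which a variable vanishes if and only if it is the chosen one
in a block `i` with `b_i s + c_i t = 0`. -/
theorem exists_algHom_of_point [IsAlgClosed 𝕂] (hr : 1 ≤ r)
    (ha : ∀ i k : Fin (r+1), i ≠ k → LinearIndependent 𝕂 ![a i, a k]) (hl : ∀ i j, 0 < l i j)
    {u v : RAnL 𝕂 r a n l}
    (hM : ∀ i, Ideal.Quotient.mk (relIdeal 𝕂 r a n l) (mono 𝕂 r n l i) =
      (a i).1 • u + (a i).2 • v)
    (j₀ : ∀ i, Fin (n i)) (s t : 𝕂) :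
    ∃ φ : RAnL 𝕂 r a n l →ₐ[𝕂] 𝕂, φ u = s ∧ φ v = t ∧
      ∀ x, φ (Ideal.Quotient.mk (relIdeal 𝕂 r a n l) (X x)) = 0 ↔
        x.2 = j₀ x.1 ∧ (a x.1).1 * s + (a x.1).2 * t = 0 := by
  choose τ hτ hτ0 using fun i => exists_prod_pow_eq (l i) (j₀ i) (hl i _)
    ((a i).1 * s + (a i).2 * t)
  let ψ : MvPolynomial (Idx r n) 𝕂 →ₐ[𝕂] 𝕂 := aeval fun x => τ x.1 x.2
  have hψ : ∀ i, ψ (mono 𝕂 r n l i) = (a i).1 * s + (a i).2 * t := fun i => by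
    simp [ψ, mono, hτ]
  have hker : ∀ p ∈ relIdeal 𝕂 r a n l, ψ p = 0 := by
    intro p hp
    have : relIdeal 𝕂 r a n l ≤ RingHom.ker ψ := by
      refine Ideal.span_le.2 ?_
      rintro _ ⟨i, j, k, -, -, rfl⟩
      simp only [SetLike.mem_coe, RingHom.mem_ker, gPoly, map_add, map_mul, hψ, alpha,
        ← algebraMap_eq, AlgHom.commutes, Algebra.algebraMap_self, RingHom.id_apply]
      ring
    exact this hp
  let φ : RAnL 𝕂 r a n l →ₐ[𝕂] 𝕂 := Ideal.Quotient.liftₐ _ ψ hker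
  have hφ : ∀ p, φ (Ideal.Quotient.mk (relIdeal 𝕂 r a n l) p) = ψ p := fun p => rfl
  have hlin : ∀ i, (a i).1 * φ u + (a i).2 * φ v = (a i).1 * s + (a i).2 * t := fun i => by
    rw [← hψ, ← hφ, hM]
    simp
  have hα : alpha 𝕂 r a ⟨0, by omega⟩ ⟨1, by omega⟩ ≠ 0 := alpha_ne_zero ha (by simp)
  refine ⟨φ, mul_left_cancel₀ hα ?_, mul_left_cancel₀ hα ?_, fun x => ?_⟩
  · simp only [alpha]
    linear_combination (a ⟨1, by omega⟩).2 * hlin ⟨0, by omega⟩ -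
      (a ⟨0, by omega⟩).2 * hlin ⟨1, by omega⟩
  · simp only [alpha]
    linear_combination (a ⟨0, by omega⟩).1 * hlin ⟨1, by omega⟩ -
      (a ⟨1, by omega⟩).1 * hlin ⟨0, by omega⟩
  · rw [hφ]
    simp [ψ, hτ0]

/-- If `p` vanishes at a point such that `p` divides all members of a family `G` vanishing there,
and homogeneous elements are products of members of `G`, then `p` is `K`-prime. -/
theorem kPrime_of_point {G : Set (RAnL 𝕂 r a n l)}
    (hG : ∀ f, (∃ d, IsHomog 𝕂 r a n l d f) → f ≠ 0 → f ∈ Submonoid.closure G)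
    {p : RAnL 𝕂 r a n l} (hp : ∃ d, IsHomog 𝕂 r a n l d p) (hp0 : p ≠ 0)
    (φ : RAnL 𝕂 r a n l →ₐ[𝕂] 𝕂) (hφ : φ p = 0) (hdvd : ∀ g ∈ G, φ g = 0 → p ∣ g) :
    KPrime 𝕂 r a n l p := by
  have key : ∀ x, (∃ d, IsHomog 𝕂 r a n l d x) → φ x = 0 → p ∣ x := by
    intro x hx h0
    rcases eq_or_ne x 0 with rfl | hx0
    · exact dvd_zero p
    have hmem := hG x hx hx0
    clear hx hx0
    induction hmem using Submonoid.closure_induction with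
    | mem g hg => exact hdvd g hg h0
    | one => simp at h0
    | mul x y _ _ hx hy =>
      rw [map_mul] at h0
      rcases mul_eq_zero.1 h0 with h | h
      · exact (hx h).mul_right y
      · exact (hy h).mul_left x
  refine ⟨hp, hp0, fun h => (h.map φ).ne_zero hφ, fun x y hx hy hxy => ?_⟩
  have h0 : φ (x * y) = 0 := by
    obtain ⟨z, hz⟩ := hxy
    rw [hz, map_mul, hφ, zero_mul]
  rw [map_mul] at h0
  exact (mul_eq_zero.1 h0).imp (key x hx) (key y hy)

theorem IsHomog.smul {d : Kgrp r n l} {f : RAnL 𝕂 r a n l} (hf : IsHomog 𝕂 r a n l d f) (c : 𝕂) :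
    IsHomog 𝕂 r a n l d (c • f) := by
  obtain ⟨p, hp, rfl⟩ := hf
  exact ⟨C c * p, hp.C_mul c, by rw [← smul_eq_C_mul]; rfl⟩

theorem KPrime.smul {p : RAnL 𝕂 r a n l} (hp : KPrime 𝕂 r a n l p) {c : 𝕂} (hc : c ≠ 0) :
    KPrime 𝕂 r a n l (c • p) := by
  obtain ⟨⟨d, hd⟩, h0, hu, hdvd⟩ := hp
  have hass : ∀ x, c • p ∣ x ↔ p ∣ x := fun x => by
    rw [smul_eq_algebraMap_mul]
    exact ((IsUnit.mk0 c hc).map (algebraMap 𝕂 (RAnL 𝕂 r a n l))).mul_left_dvd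
  refine ⟨⟨d, hd.smul c⟩, smul_ne_zero hc h0, ?_, ?_⟩
  · rwa [isUnit_iff_dvd_one, hass, ← isUnit_iff_dvd_one]
  · simpa only [hass] using hdvd

/-- Two vectors of the plane with vanishing determinant are proportional. -/
theorem exists_smul_eq_of_det_eq_zero {K : Type*} [Field K] {p q : K × K} (hp : p ≠ 0)
    (h : q.1 * p.2 - q.2 * p.1 = 0) : ∃ s : K, q = s • p := by
  by_cases h1 : p.1 = 0
  · have h2 : p.2 ≠ 0 := fun h2 => hp (Prod.ext h1 h2)
    refine ⟨q.2 / p.2, Prod.ext ?_ ?_⟩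
    · simp only [Prod.smul_fst, smul_eq_mul]
      field_simp
      linear_combination h
    · simp [h2]
  · refine ⟨q.1 / p.1, Prod.ext ?_ ?_⟩
    · simp [h1]
    · simp only [Prod.smul_snd, smul_eq_mul]
      field_simp
      linear_combination -h

/-- Every homogeneous nonzero nonunit of `R(A, 𝔫, L)` is a product of `K`-prime elements. -/
theorem exists_multiset_kPrime [IsAlgClosed 𝕂] (hr : 1 ≤ r)
    (ha : ∀ i k : Fin (r+1), i ≠ k → LinearIndependent 𝕂 ![a i, a k])
    (hn : ∀ i, 0 < n i) (hl : ∀ i j, 0 < l i j) {f : RAnL 𝕂 r a n l}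
    (hf : ∃ d, IsHomog 𝕂 r a n l d f) (hf0 : f ≠ 0) (hfu : ¬ IsUnit f) :
    ∃ ms : Multiset (RAnL 𝕂 r a n l), (∀ p ∈ ms, KPrime 𝕂 r a n l p) ∧ ms.prod = f := by
  obtain ⟨u, v, hM, hlin⟩ := exists_mono_eq_linear (n := n) (l := l) hr ha
  set T : Idx r n → RAnL 𝕂 r a n l := fun x => Ideal.Quotient.mk (relIdeal 𝕂 r a n l) (X x)
  have hane : ∀ i, a i ≠ 0 := fun i => by
    have : Nontrivial (Fin (r+1)) := Fin.nontrivial_iff_two_le.2 (by omega)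
    obtain ⟨k, hk⟩ := exists_ne i
    simpa using (ha i k hk.symm).ne_zero 0
  have hsmul : ∀ i (s : 𝕂), (s • a i).1 • u + (s • a i).2 • v =
      s • Ideal.Quotient.mk (relIdeal 𝕂 r a n l) (mono 𝕂 r n l i) := fun i s => by
    rw [hM, smul_add, smul_smul, smul_smul]
    rfl
  have hTdvd : ∀ (i) (j : Fin (n i)) (s : 𝕂),
      T ⟨i, j⟩ ∣ (s • a i).1 • u + (s • a i).2 • v := by
    intro i j s
    rw [hsmul, mono, map_prod]
    refine dvd_smul_of_dvd s (Dvd.dvd.trans ?_ (Finset.dvd_prod_of_mem _ (Finset.mem_univ j)))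
    rw [map_pow]
    exact dvd_pow_self _ (hl i j).ne'
  let G : Set (RAnL 𝕂 r a n l) := {g | (∃ c : 𝕂, c ≠ 0 ∧ algebraMap 𝕂 _ c = g) ∨
    (∃ x, T x = g) ∨ ∃ q : 𝕂 × 𝕂, q ≠ 0 ∧ q.1 • u + q.2 • v = g}
  have hG : ∀ f, (∃ d, IsHomog 𝕂 r a n l d f) → f ≠ 0 → f ∈ Submonoid.closure G := by
    rintro f ⟨d, hd⟩ hf0
    exact mem_of_isHomog hn hl hM _ (fun c hc => Submonoid.subset_closure (.inl ⟨c, hc, rfl⟩))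
      (fun x => Submonoid.subset_closure (.inr (.inl ⟨x, rfl⟩)))
      (fun q hq => Submonoid.subset_closure (.inr (.inr ⟨q, hq, rfl⟩))) hd hf0
  have hprimeT : ∀ x, T x ≠ 0 → KPrime 𝕂 r a n l (T x) := by
    rintro ⟨i, j⟩ hx
    obtain ⟨φ, hφu, hφv, hφ⟩ := exists_algHom_of_point hr ha hl hM
      (Function.update (fun i => ⟨0, hn i⟩) i j) (a i).2 (-(a i).1)
    refine kPrime_of_point hG ⟨_, X ⟨i, j⟩, isWeightedHomogeneous_X 𝕂 _ _, rfl⟩ hx φ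
      ((hφ _).2 ⟨by simp, by ring⟩) ?_
    rintro _ (⟨c, hc, rfl⟩ | ⟨⟨k, j'⟩, rfl⟩ | ⟨q, hq, rfl⟩) h
    · simp [hc] at h
    · obtain ⟨h1, h2⟩ := (hφ _).1 h
      have hki : k = i := by
        by_contra hne
        refine alpha_ne_zero ha hne ?_
        simp only [alpha]
        simp only at h2
        linear_combination h2
      subst hki
      simp only [Function.update_self] at h1
      rw [h1]
    · simp only [map_add, map_smul, hφu, hφv, smul_eq_mul] at h
      obtain ⟨s, rfl⟩ := exists_smul_eq_of_det_eq_zero (hane i) (q := q) (by linear_combination h)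
      exact hTdvd i j s
  have hprimeL : ∀ q : 𝕂 × 𝕂, q ≠ 0 → (∀ i, (a i).1 * q.2 - (a i).2 * q.1 ≠ 0) →
      q.1 • u + q.2 • v ≠ 0 → KPrime 𝕂 r a n l (q.1 • u + q.2 • v) := by
    intro q hq hqa hq0
    obtain ⟨φ, hφu, hφv, hφ⟩ := exists_algHom_of_point hr ha hl hM
      (fun i => ⟨0, hn i⟩) q.2 (-q.1)
    refine kPrime_of_point hG (hlin q) hq0 φ ?_ ?_
    · simp only [map_add, map_smul, hφu, hφv, smul_eq_mul]
      ring
    rintro _ (⟨c, hc, rfl⟩ | ⟨x, rfl⟩ | ⟨q', hq', rfl⟩) h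
    · simp [hc] at h
    · exact absurd (by linear_combination ((hφ _).1 h).2) (hqa x.1)
    · simp only [map_add, map_smul, hφu, hφv, smul_eq_mul] at h
      obtain ⟨s, rfl⟩ := exists_smul_eq_of_det_eq_zero hq (q := q') (by linear_combination h)
      refine ⟨algebraMap 𝕂 _ s, ?_⟩
      simp only [Prod.smul_fst, Prod.smul_snd, smul_eq_mul, smul_eq_algebraMap_mul, map_mul]
      ring
  let N : Submonoid (RAnL 𝕂 r a n l) :=
    { carrier := {g | g ≠ 0 → ∃ c : 𝕂, c ≠ 0 ∧ ∃ ms : Multiset (RAnL 𝕂 r a n l),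
        (∀ p ∈ ms, KPrime 𝕂 r a n l p) ∧ c • ms.prod = g}
      one_mem' := fun _ => ⟨1, one_ne_zero, 0, by simp, by simp⟩
      mul_mem' := by
        intro x y hx hy hxy
        obtain ⟨c, hc, ms, hms, rfl⟩ := hx (left_ne_zero_of_mul hxy)
        obtain ⟨c', hc', ms', hms', rfl⟩ := hy (right_ne_zero_of_mul hxy)
        refine ⟨c * c', mul_ne_zero hc hc', ms + ms', fun p hp => ?_, ?_⟩
        · exact (Multiset.mem_add.1 hp).elim (hms p) (hms' p)
        · rw [Multiset.prod_add, smul_eq_algebraMap_mul, smul_eq_algebraMap_mul,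
            smul_eq_algebraMap_mul, map_mul]
          ring }
  have hcN : ∀ c : 𝕂, c ≠ 0 → algebraMap 𝕂 _ c ∈ N := fun c hc _ =>
    ⟨c, hc, 0, by simp, by rw [Multiset.prod_zero, smul_eq_algebraMap_mul, mul_one]⟩
  have hTN : ∀ x, T x ∈ N := fun x hx =>
    ⟨1, one_ne_zero, {T x}, by simpa using hprimeT x hx, by simp⟩
  have hLN : ∀ q : 𝕂 × 𝕂, q ≠ 0 → q.1 • u + q.2 • v ∈ N := by
    intro q hq
    by_cases hqa : ∀ i, (a i).1 * q.2 - (a i).2 * q.1 ≠ 0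
    · exact fun hq0 => ⟨1, one_ne_zero, {q.1 • u + q.2 • v},
        by simpa using hprimeL q hq hqa hq0, by simp⟩
    push Not at hqa
    obtain ⟨i, hi⟩ := hqa
    obtain ⟨s, rfl⟩ := exists_smul_eq_of_det_eq_zero (hane i) (q := q) (by linear_combination -hi)
    rw [hsmul, smul_eq_algebraMap_mul, mono, map_prod]
    refine mul_mem (hcN s (by rintro rfl; simp at hq)) (prod_mem fun j _ => ?_)
    rw [map_pow]
    exact pow_mem (hTN _) _
  obtain ⟨d, hd⟩ := hf
  obtain ⟨c, hc, ms, hms, rfl⟩ := mem_of_isHomog hn hl hM N hcN hTN hLN hd hf0 hf0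
  induction ms using Multiset.induction_on with
  | empty =>
    refine absurd ?_ hfu
    rw [Multiset.prod_zero, smul_eq_algebraMap_mul, mul_one]
    exact (IsUnit.mk0 c hc).map _
  | cons p ms _ =>
    refine ⟨(c • p) ::ₘ ms, fun q hq => ?_, by simp [smul_mul_assoc]⟩
    rcases Multiset.mem_cons.1 hq with rfl | hq
    · exact (hms p (Multiset.mem_cons_self _ _)).smul hc
    · exact hms q (Multiset.mem_cons_of_mem hq)

end FactoriallyGraded

section Statement6

/-- `R(A,𝔫,L)` is factorially `K`-graded: every homogeneous nonzero nonunit is a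
product of `K`-prime elements. Moreover the `K`-grading is effective: the degrees
`Q(e_{ij})` generate `K`. -/
theorem statement6 (𝕂 : Type) [Field 𝕂] [IsAlgClosed 𝕂] [CharZero 𝕂]
    (r : ℕ) (hr : 1 ≤ r) (a : Fin (r+1) → 𝕂 × 𝕂)
    (ha : ∀ i k : Fin (r+1), i ≠ k → LinearIndependent 𝕂 ![a i, a k])
    (n : Fin (r+1) → ℕ) (hn : ∀ i, 0 < n i)
    (l : ∀ i : Fin (r+1), Fin (n i) → ℕ) (hl : ∀ i j, 0 < l i j) :
    (∀ f : RAnL 𝕂 r a n l, (∃ d, IsHomog 𝕂 r a n l d f) → f ≠ 0 → ¬ IsUnit f →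
      ∃ ms : Multiset (RAnL 𝕂 r a n l), (∀ p ∈ ms, KPrime 𝕂 r a n l p) ∧ ms.prod = f) ∧
    AddSubgroup.closure (Set.range (wK r n l)) = ⊤ := by
  exact ⟨fun _ hf hf0 hfu => exists_multiset_kPrime hr ha hn hl hf hf0 hfu, closure_range_wK⟩

end Statement6
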